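/- arXiv:2107.14103 — 3 statements merged into one kernel-verified Lean document; each statement's English description precedes it below -/
import Mathlib

section
/- Uncertainty principle for the magnetic Schrödinger operator via a landscape function (classical version of Theorem 1.11): let n ≥ 2, let Ω ⊆ ℝⁿ be open, let a = (a₁,…,aₙ) be a C¹ real vector field on Ω, let V : Ω → ℝ be continuous, and let S be a selection of pairs such that W := Σ_S B + V is continuous and nonnegative on Ω. Suppose u ∈ C²(Ω) satisfies u > 0 on Ω and −Δu + W u = 1 pointwise on Ω. Then for every smooth compactly supported f : Ω → ℂ, ∫_Ω |f|²/u ≤ ∫_Ω [ n |D_a f|² + V |f|² ], where |D_a f|² = Σ_{k=1}^n |D_{k,a} f|². -/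
open MeasureTheory Metric

noncomputable section

/-- Partial derivative `∂f/∂x_j` of a complex-valued function on `ℝⁿ`. -/
def pdC {n : ℕ} (j : Fin n) (f : EuclideanSpace ℝ (Fin n) → ℂ)
    (x : EuclideanSpace ℝ (Fin n)) : ℂ :=
  fderiv ℝ f x (EuclideanSpace.single j 1)

/-- Partial derivative `∂g/∂x_j` of a real-valued function on `ℝⁿ`. -/
def pdR {n : ℕ} (j : Fin n) (g : EuclideanSpace ℝ (Fin n) → ℝ)
    (x : EuclideanSpace ℝ (Fin n)) : ℝ :=
  fderiv ℝ g x (EuclideanSpace.single j 1)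

/-- The Laplacian `Δg = Σ_j ∂²g/∂x_j²`. -/
def lap {n : ℕ} (g : EuclideanSpace ℝ (Fin n) → ℝ) (x : EuclideanSpace ℝ (Fin n)) : ℝ :=
  ∑ j, pdR j (pdR j g) x

/-- Magnetic derivative `D_{j,a} f = ∂f/∂x_j − i a_j f`. -/
def magD {n : ℕ} (a : Fin n → EuclideanSpace ℝ (Fin n) → ℝ) (j : Fin n)
    (f : EuclideanSpace ℝ (Fin n) → ℂ) (x : EuclideanSpace ℝ (Fin n)) : ℂ :=
  pdC j f x - Complex.I * (a j x : ℂ) * f x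

/-- Component `b_{jk} = ∂a_j/∂x_k − ∂a_k/∂x_j` of the magnetic field. -/
def Bfield {n : ℕ} (a : Fin n → EuclideanSpace ℝ (Fin n) → ℝ) (j k : Fin n)
    (x : EuclideanSpace ℝ (Fin n)) : ℝ :=
  pdR k (a j) x - pdR j (a k) x

/-- A selection of pairs: for each `j ≠ k`, exactly one of `(j,k)`, `(k,j)` belongs
to `S`, and `S` contains no diagonal pairs. -/
def IsSelection {n : ℕ} (S : Finset (Fin n × Fin n)) : Prop :=
  (∀ p ∈ S, p.1 ≠ p.2) ∧ ∀ j k : Fin n, j ≠ k → ((j, k) ∈ S ↔ (k, j) ∉ S)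

section Helpers

variable {n : ℕ}

lemma pdR_add' (j : Fin n) {g h : EuclideanSpace ℝ (Fin n) → ℝ} {x : EuclideanSpace ℝ (Fin n)}
    (hg : DifferentiableAt ℝ g x) (hh : DifferentiableAt ℝ h x) :
    pdR j (fun y => g y + h y) x = pdR j g x + pdR j h x := by
  unfold pdR
  have h1 : HasFDerivAt (fun y => g y + h y) (fderiv ℝ g x + fderiv ℝ h x) x :=
    hg.hasFDerivAt.add hh.hasFDerivAt
  rw [h1.fderiv]
  simp

lemma pdR_mul' (j : Fin n) {g h : EuclideanSpace ℝ (Fin n) → ℝ} {x : EuclideanSpace ℝ (Fin n)}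
    (hg : DifferentiableAt ℝ g x) (hh : DifferentiableAt ℝ h x) :
    pdR j (fun y => g y * h y) x = g x * pdR j h x + h x * pdR j g x := by
  unfold pdR
  have h1 : HasFDerivAt (fun y => g y * h y) (g x • fderiv ℝ h x + h x • fderiv ℝ g x) x :=
    hg.hasFDerivAt.mul hh.hasFDerivAt
  rw [h1.fderiv]
  simp

lemma pdR_inv' (j : Fin n) {g : EuclideanSpace ℝ (Fin n) → ℝ} {x : EuclideanSpace ℝ (Fin n)}
    (hg : DifferentiableAt ℝ g x) (h0 : g x ≠ 0) :
    pdR j (fun y => (g y)⁻¹) x = - pdR j g x * ((g x)⁻¹) ^ 2 := by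
  unfold pdR
  have h1 := (hasDerivAt_inv h0).comp_hasFDerivAt x hg.hasFDerivAt
  have h2 : HasFDerivAt (fun y => (g y)⁻¹) (-(g x ^ 2)⁻¹ • fderiv ℝ g x) x := h1
  rw [h2.fderiv]
  simp
  ring

lemma pdR_const_mul' (j : Fin n) (c : ℝ) {g : EuclideanSpace ℝ (Fin n) → ℝ}
    {x : EuclideanSpace ℝ (Fin n)} (hg : DifferentiableAt ℝ g x) :
    pdR j (fun y => c * g y) x = c * pdR j g x := by
  rw [pdR_mul' j (differentiableAt_const c) hg]
  simp [pdR]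

lemma pdR_contDiffOn (j : Fin n) {Ω : Set (EuclideanSpace ℝ (Fin n))} (hΩ : IsOpen Ω)
    {g : EuclideanSpace ℝ (Fin n) → ℝ} (hg : ContDiffOn ℝ 2 g Ω) :
    ContDiffOn ℝ 1 (pdR j g) Ω :=
  (hg.fderiv_of_isOpen hΩ (m := 1) (by norm_num)).clm_apply contDiffOn_const

lemma pdR_continuousOn (j : Fin n) {Ω : Set (EuclideanSpace ℝ (Fin n))} (hΩ : IsOpen Ω)
    {g : EuclideanSpace ℝ (Fin n) → ℝ} (hg : ContDiffOn ℝ 1 g Ω) :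
    ContinuousOn (pdR j g) Ω :=
  (hg.continuousOn_fderiv_of_isOpen hΩ le_rfl).clm_apply continuousOn_const

lemma integrable_of_cont {Ω K : Set (EuclideanSpace ℝ (Fin n))}
    (hK : IsCompact K) (hKΩ : K ⊆ Ω) {g : EuclideanSpace ℝ (Fin n) → ℝ}
    (hg : ContinuousOn g Ω) (h0 : ∀ x, x ∉ K → g x = 0) : Integrable g :=
  ((hg.mono hKΩ).integrableOn_compact hK).integrable_of_forall_notMem_eq_zero h0

lemma pdR_zero_off (j : Fin n) {K : Set (EuclideanSpace ℝ (Fin n))} (hK : IsCompact K)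
    {g : EuclideanSpace ℝ (Fin n) → ℝ} (h0 : ∀ x, x ∉ K → g x = 0) :
    ∀ x, x ∉ K → pdR j g x = 0 := by
  intro x hx
  have : g =ᶠ[nhds x] fun _ => 0 := by
    filter_upwards [hK.isClosed.isOpen_compl.mem_nhds hx] with y hy using h0 y hy
  unfold pdR
  rw [this.fderiv_eq]
  simp

lemma div_zero_aux (j : Fin n) {Ω K : Set (EuclideanSpace ℝ (Fin n))} (hΩ : IsOpen Ω)
    (hK : IsCompact K) (hKΩ : K ⊆ Ω) {g : EuclideanSpace ℝ (Fin n) → ℝ}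
    (hg : ContDiffOn ℝ 1 g Ω) (h0 : ∀ x, x ∉ K → g x = 0) :
    IntegrableOn (pdR j g) Ω ∧ ∫ x in Ω, pdR j g x = 0 := by
  have hz := pdR_zero_off j hK h0
  have hi : Integrable (pdR j g) := integrable_of_cont hK hKΩ (pdR_continuousOn j hΩ hg) hz
  have hig : Integrable g := integrable_of_cont hK hKΩ hg.continuousOn h0
  refine ⟨hi.integrableOn, ?_⟩
  rw [setIntegral_eq_integral_of_forall_compl_eq_zero
    (fun x hx => hz x (fun h => hx (hKΩ h)))]
  have hd : Differentiable ℝ g := by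
    intro x
    by_cases hx : x ∈ K
    · exact (hg.contDiffAt (hΩ.mem_nhds (hKΩ hx))).differentiableAt one_ne_zero
    · have : g =ᶠ[nhds x] fun _ => 0 := by
        filter_upwards [hK.isClosed.isOpen_compl.mem_nhds hx] with y hy using h0 y hy
      exact this.differentiableAt_iff.2 (differentiableAt_const _)
  have := integral_mul_fderiv_eq_neg_fderiv_mul_of_integrable (𝕜 := ℝ) (μ := volume)
    (f := fun _ : EuclideanSpace ℝ (Fin n) => (1 : ℝ)) (g := g)
    (v := EuclideanSpace.single j 1) (by simp) (by
      simp only [one_mul]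
      exact hi) (by simpa using hig)
    (fun x _ => by fun_prop) (fun x _ => hd x)
  simpa [pdR] using this

lemma selection_sum {S : Finset (Fin n × Fin n)} (hS : IsSelection S) (d : Fin n → ℝ) :
    ∑ p ∈ S, (d p.1 + d p.2) = ((n : ℝ) - 1) * ∑ k, d k := by
  classical
  have h1 : ∀ e : Fin n × Fin n → ℝ, ∑ p ∈ S, e p
      = ∑ j, ∑ k, if (j, k) ∈ S then e (j, k) else 0 := by
    intro e
    rw [← Fintype.sum_prod_type' (f := fun j k => if (j, k) ∈ S then e (j, k) else 0)]
    simp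
  rw [Finset.sum_add_distrib, h1 (fun p => d p.1), h1 (fun p => d p.2)]
  rw [Finset.sum_comm (f := fun j k => if (j, k) ∈ S then d (j, k).2 else 0),
    ← Finset.sum_add_distrib, Finset.mul_sum]
  refine Finset.sum_congr rfl fun j _ => ?_
  rw [← Finset.sum_add_distrib]
  have : ∀ k, ((if (j, k) ∈ S then d j else 0) + (if (k, j) ∈ S then d j else 0))
      = d j - if k = j then d j else 0 := by
    intro k
    by_cases hjk : j = k
    · subst hjk
      have : (j, j) ∉ S := fun h => hS.1 _ h rfl
      simp [this]
    · have h2 := hS.2 j k hjk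
      by_cases h3 : (j, k) ∈ S
      · simp [h3, h2.1 h3, Ne.symm hjk]
      · have : (k, j) ∈ S := by by_contra h; exact h3 (h2.2 h)
        simp [h3, this, Ne.symm hjk]
  simp only [this, Finset.sum_sub_distrib]
  simp
  ring

lemma normSq_magD (a : Fin n → EuclideanSpace ℝ (Fin n) → ℝ) (j : Fin n)
    {f : EuclideanSpace ℝ (Fin n) → ℂ} {x : EuclideanSpace ℝ (Fin n)}
    (hf : DifferentiableAt ℝ f x) :
    ‖magD a j f x‖ ^ 2 = (pdR j (fun y => (f y).re) x + a j x * (f x).im) ^ 2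
      + (pdR j (fun y => (f y).im) x - a j x * (f x).re) ^ 2 := by
  have h1 : pdR j (fun y => (f y).re) x = (pdC j f x).re := by
    have : HasFDerivAt (fun y => (f y).re) (Complex.reCLM.comp (fderiv ℝ f x)) x :=
      Complex.reCLM.hasFDerivAt.comp x hf.hasFDerivAt
    unfold pdR pdC
    rw [this.fderiv]
    simp
  have h2 : pdR j (fun y => (f y).im) x = (pdC j f x).im := by
    have : HasFDerivAt (fun y => (f y).im) (Complex.imCLM.comp (fderiv ℝ f x)) x :=
      Complex.imCLM.hasFDerivAt.comp x hf.hasFDerivAt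
    unfold pdR pdC
    rw [this.fderiv]
    simp
  rw [h1, h2, Complex.sq_norm, Complex.normSq_apply, magD]
  simp
  ring

/-- symmetry of second derivatives -/
lemma pdR_comm (j k : Fin n) {g : EuclideanSpace ℝ (Fin n) → ℝ} (hg : ContDiff ℝ 2 g)
    (x : EuclideanSpace ℝ (Fin n)) : pdR j (pdR k g) x = pdR k (pdR j g) x := by
  have hs := (hg.contDiffAt (x := x)).isSymmSndFDerivAt (by simp)
  have hd : DifferentiableAt ℝ (fderiv ℝ g) x :=
    (hg.fderiv_right (m := 1) (by norm_num)).differentiable one_ne_zero x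
  have key : ∀ j k : Fin n, pdR j (pdR k g) x
      = fderiv ℝ (fderiv ℝ g) x (EuclideanSpace.single j 1) (EuclideanSpace.single k 1) := by
    intro j k
    have : HasFDerivAt (pdR k g) _ x :=
      hd.hasFDerivAt.clm_apply (hasFDerivAt_const (EuclideanSpace.single k (1:ℝ)) x)
    rw [pdR, this.fderiv]
    simp
  rw [key, key]
  exact hs _ _

end Helpers

/-- Uncertainty principle for the magnetic Schrödinger operator via a landscape
function (classical version of Theorem 1.11): if `W = Σ_S B + V ≥ 0` is continuous on
`Ω` and `u > 0` solves `−Δu + Wu = 1` on `Ω`, then for every smooth compactly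
supported complex `f`, `∫ |f|²/u ≤ ∫ [n |D_a f|² + V |f|²]`. -/
theorem magnetic_uncertainty_principle_landscape
    (n : ℕ) (hn : 2 ≤ n) (Ω : Set (EuclideanSpace ℝ (Fin n))) (hΩ : IsOpen Ω)
    (a : Fin n → EuclideanSpace ℝ (Fin n) → ℝ) (ha : ∀ j, ContDiffOn ℝ 1 (a j) Ω)
    (V : EuclideanSpace ℝ (Fin n) → ℝ) (hVc : ContinuousOn V Ω)
    (S : Finset (Fin n × Fin n)) (hS : IsSelection S)
    (W : EuclideanSpace ℝ (Fin n) → ℝ)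
    (hW : ∀ x, W x = (∑ p ∈ S, Bfield a p.1 p.2 x) + V x)
    (hWc : ContinuousOn W Ω) (hW0 : ∀ x ∈ Ω, 0 ≤ W x)
    (u : EuclideanSpace ℝ (Fin n) → ℝ) (hu : ContDiffOn ℝ 2 u Ω)
    (hupos : ∀ x ∈ Ω, 0 < u x)
    (hueq : ∀ x ∈ Ω, -lap u x + W x * u x = 1) :
    ∀ f : EuclideanSpace ℝ (Fin n) → ℂ, ContDiff ℝ (⊤ : ℕ∞) f → HasCompactSupport f →
      tsupport f ⊆ Ω →
      ∫ x in Ω, ‖f x‖ ^ 2 / u x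
        ≤ ∫ x in Ω, ((n : ℝ) * ∑ k, ‖magD a k f x‖ ^ 2 + V x * ‖f x‖ ^ 2) := by
  intro f hf hfc hfΩ
  set K := tsupport f with hKdef
  have hK : IsCompact K := hfc
  set p : EuclideanSpace ℝ (Fin n) → ℝ := fun y => (f y).re with hp
  set q : EuclideanSpace ℝ (Fin n) → ℝ := fun y => (f y).im with hq
  have hf2 : ContDiff ℝ 2 f := hf.of_le (by
    have : ((2 : ℕ∞) : WithTop ℕ∞) ≤ ((⊤ : ℕ∞) : WithTop ℕ∞) := WithTop.coe_le_coe.2 le_top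
    exact this)
  have hp2 : ContDiff ℝ 2 p := Complex.reCLM.contDiff.comp hf2
  have hq2 : ContDiff ℝ 2 q := Complex.imCLM.contDiff.comp hf2
  have hp1 : ContDiff ℝ 1 p := hp2.of_le (by norm_num)
  have hq1 : ContDiff ℝ 1 q := hq2.of_le (by norm_num)
  have hf0 : ∀ x, x ∉ K → f x = 0 := fun x hx => image_eq_zero_of_notMem_tsupport hx
  have hp0 : ∀ x, x ∉ K → p x = 0 := fun x hx => by simp [hp, hf0 x hx]
  have hq0 : ∀ x, x ∉ K → q x = 0 := fun x hx => by simp [hq, hf0 x hx]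
  set N : EuclideanSpace ℝ (Fin n) → ℝ := fun y => p y * p y + q y * q y with hN
  have hN1 : ContDiff ℝ 1 N := (hp1.mul hp1).add (hq1.mul hq1)
  have hN0 : ∀ x, x ∉ K → N x = 0 := fun x hx => by simp [hN, hp0 x hx, hq0 x hx]
  have hnorm : ∀ x, ‖f x‖ ^ 2 = N x := fun x => by
    rw [Complex.sq_norm, Complex.normSq_apply]
  have hu1 : ContDiffOn ℝ 1 u Ω := hu.of_le (by norm_num)
  set M : Fin n → EuclideanSpace ℝ (Fin n) → ℝ := fun k x =>
    (pdR k p x + a k x * q x) ^ 2 + (pdR k q x - a k x * p x) ^ 2 with hM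
  have hmag : ∀ k x, ‖magD a k f x‖ ^ 2 = M k x := fun k x =>
    normSq_magD a k (hf2.differentiable two_ne_zero x)
  simp only [hnorm, hmag]
  -- the vector fields
  set G : Fin n → EuclideanSpace ℝ (Fin n) → ℝ := fun j y => pdR j u y * (N y * (u y)⁻¹) with hG
  set H : Fin n → Fin n → EuclideanSpace ℝ (Fin n) → ℝ :=
    fun j k y => 2 * (q y * pdR k p y) + a k y * N y with hH
  have huinv : ContDiffOn ℝ 1 (fun y => (u y)⁻¹) Ω := hu1.inv fun x hx => (hupos x hx).ne'
  have hpk : ∀ k, ContDiffOn ℝ 1 (pdR k p) Ω := fun k => pdR_contDiffOn k hΩ hp2.contDiffOn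
  have hqk : ∀ k, ContDiffOn ℝ 1 (pdR k q) Ω := fun k => pdR_contDiffOn k hΩ hq2.contDiffOn
  have huk : ∀ k, ContDiffOn ℝ 1 (pdR k u) Ω := fun k => pdR_contDiffOn k hΩ hu
  have hG1 : ∀ j, ContDiffOn ℝ 1 (G j) Ω := fun j =>
    (huk j).mul (hN1.contDiffOn.mul huinv)
  have hH1 : ∀ j k, ContDiffOn ℝ 1 (H j k) Ω := fun j k =>
    (contDiffOn_const.mul (hq1.contDiffOn.mul (hpk k))).add ((ha k).mul hN1.contDiffOn)
  have hGd := fun j => div_zero_aux j hΩ hK hfΩ (hG1 j)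
    (fun x hx => by simp [hG, hN0 x hx])
  have hHd := fun i j k => div_zero_aux i hΩ hK hfΩ (hH1 j k)
    (fun x hx => by simp [hH, hN0 x hx, hq0 x hx])
  have hMc : ∀ k, ContinuousOn (M k) Ω := fun k =>
    (((hpk k).continuousOn.add ((ha k).continuousOn.mul hq1.continuous.continuousOn)).pow 2).add
    (((hqk k).continuousOn.sub ((ha k).continuousOn.mul hp1.continuous.continuousOn)).pow 2)
  have hM0 : ∀ k x, x ∉ K → M k x = 0 := fun k x hx => by
    simp [hM, hp0 x hx, hq0 x hx, pdR_zero_off k hK hp0 x hx, pdR_zero_off k hK hq0 x hx]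
  have hR : IntegrableOn (fun x => (n : ℝ) * ∑ k, M k x + V x * N x) Ω :=
    (integrable_of_cont hK hfΩ
      ((continuousOn_const.mul (continuousOn_finsetSum _ fun k _ => hMc k)).add
        (hVc.mul hN1.continuous.continuousOn))
      (fun x hx => by simp [hM0 _ x hx, hN0 x hx])).integrableOn
  have hL : IntegrableOn (fun x => N x / u x) Ω :=
    (integrable_of_cont hK hfΩ
      (hN1.continuous.continuousOn.div hu.continuousOn fun x hx => (hupos x hx).ne')
      (fun x hx => by simp [hN0 x hx])).integrableOn
  have hD1 : IntegrableOn (fun x => ∑ j, pdR j (G j) x) Ω :=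
    integrable_finsetSum _ fun j _ => (hGd j).1
  have hD2 : IntegrableOn (fun x => ∑ s ∈ S, (pdR s.1 (H s.1 s.2) x - pdR s.2 (H s.2 s.1) x)) Ω :=
    integrable_finsetSum _ fun s _ => (hHd s.1 s.1 s.2).1.sub (hHd s.2 s.2 s.1).1
  have hI1 : ∫ x in Ω, ∑ j, pdR j (G j) x = 0 := by
    rw [integral_finsetSum _ fun j _ => (hGd j).1]
    exact Finset.sum_eq_zero fun j _ => (hGd j).2
  have hI2 : ∫ x in Ω, ∑ s ∈ S, (pdR s.1 (H s.1 s.2) x - pdR s.2 (H s.2 s.1) x) = 0 := by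
    rw [integral_finsetSum (μ := volume.restrict Ω) S
      (f := fun (s : Fin n × Fin n) x => pdR s.1 (H s.1 s.2) x - pdR s.2 (H s.2 s.1) x)
      fun s _ => (hHd s.1 s.1 s.2).1.sub (hHd s.2 s.2 s.1).1]
    refine Finset.sum_eq_zero fun s _ => ?_
    rw [integral_sub (hHd s.1 s.1 s.2).1 (hHd s.2 s.2 s.1).1, (hHd s.1 s.1 s.2).2,
      (hHd s.2 s.2 s.1).2, sub_zero]
  -- pointwise inequality
  have hpt : ∀ x ∈ Ω, N x / u x + (∑ j, pdR j (G j) x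
      + ∑ s ∈ S, (pdR s.1 (H s.1 s.2) x - pdR s.2 (H s.2 s.1) x))
      ≤ (n : ℝ) * ∑ k, M k x + V x * N x := by
    intro x hx
    have hdO : ∀ {g : EuclideanSpace ℝ (Fin n) → ℝ}, ContDiffOn ℝ 1 g Ω →
        DifferentiableAt ℝ g x := fun hg =>
      (hg.contDiffAt (hΩ.mem_nhds hx)).differentiableAt one_ne_zero
    have hup := hupos x hx
    have dp := hdO hp1.contDiffOn
    have dq := hdO hq1.contDiffOn
    have dN := hdO hN1.contDiffOn
    have dNj : ∀ j, pdR j N x = 2 * (p x * pdR j p x + q x * pdR j q x) := by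
      intro j
      rw [hN, pdR_add' j (dp.fun_mul dp) (dq.fun_mul dq), pdR_mul' j dp dp, pdR_mul' j dq dq]
      ring
    have dG : ∀ j, pdR j (G j) x = pdR j (pdR j u) x * (N x * (u x)⁻¹)
        + pdR j u x * (u x)⁻¹ * (2 * (p x * pdR j p x + q x * pdR j q x))
        - N x * (pdR j u x * (u x)⁻¹) ^ 2 := by
      intro j
      change pdR j (fun y => pdR j u y * (N y * (u y)⁻¹)) x = _
      rw [pdR_mul' j (hdO (huk j)) (dN.fun_mul (hdO huinv)), pdR_mul' j dN (hdO huinv),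
        pdR_inv' j (hdO hu1) hup.ne', dNj]
      ring
    have dG' : ∀ j, pdR j (G j) x ≤ pdR j (pdR j u) x * (N x * (u x)⁻¹) + M j x := by
      intro j
      rw [dG]
      simp only [hM, hN]
      nlinarith [sq_nonneg (pdR j p x + a j x * q x - pdR j u x * (u x)⁻¹ * p x),
        sq_nonneg (pdR j q x - a j x * p x - pdR j u x * (u x)⁻¹ * q x)]
    have h1 : N x / u x + ∑ j, pdR j (G j) x ≤ W x * N x + ∑ j, M j x := by
      have h2 : ∑ j, pdR j (G j) x ≤ lap u x * (N x * (u x)⁻¹) + ∑ j, M j x := by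
        rw [lap, Finset.sum_mul, ← Finset.sum_add_distrib]
        exact Finset.sum_le_sum fun j _ => dG' j
      have h3 : N x / u x + lap u x * (N x * (u x)⁻¹) = W x * N x := by
        have := hueq x hx
        field_simp
        linear_combination (-N x) * this
      linarith
    have dH : ∀ i j k, pdR i (H j k) x = 2 * (q x * pdR i (pdR k p) x + pdR k p x * pdR i q x)
        + (a k x * (2 * (p x * pdR i p x + q x * pdR i q x)) + N x * pdR i (a k) x) := by
      intro i j k
      change pdR i (fun y => 2 * (q y * pdR k p y) + a k y * N y) x = _
      rw [pdR_add' i ((dq.fun_mul (hdO (hpk k))).const_mul 2) ((hdO (ha k)).fun_mul dN),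
        pdR_const_mul' i 2 (dq.fun_mul (hdO (hpk k))), pdR_mul' i dq (hdO (hpk k)),
        pdR_mul' i (hdO (ha k)) dN, dNj]
    have h4 : ∀ j k, Bfield a j k x * N x + (pdR j (H j k) x - pdR k (H k j) x)
        ≤ M j x + M k x := by
      intro j k
      rw [dH j j k, dH k k j, pdR_comm j k hp2]
      simp only [hM, hN, Bfield]
      nlinarith [sq_nonneg (pdR j q x - a j x * p x - (pdR k p x + a k x * q x)),
        sq_nonneg (pdR j p x + a j x * q x + (pdR k q x - a k x * p x))]
    have h5 : (∑ s ∈ S, Bfield a s.1 s.2 x) * N x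
        + ∑ s ∈ S, (pdR s.1 (H s.1 s.2) x - pdR s.2 (H s.2 s.1) x)
        ≤ ((n : ℝ) - 1) * ∑ k, M k x := by
      rw [← selection_sum hS (fun k => M k x), Finset.sum_mul, ← Finset.sum_add_distrib]
      exact Finset.sum_le_sum fun s _ => h4 s.1 s.2
    rw [hW] at h1
    linarith
  have hmono := setIntegral_mono_on (hL.add (hD1.add hD2)) hR hΩ.measurableSet hpt
  have e1 : ∫ x in Ω, (N x / u x + (∑ j, pdR j (G j) x
      + ∑ s ∈ S, (pdR s.1 (H s.1 s.2) x - pdR s.2 (H s.2 s.1) x))) = ∫ x in Ω, N x / u x := by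
    have e2 := integral_add hL (hD1.add hD2)
    have e3 := integral_add hD1 hD2
    simp only [Pi.add_apply] at e2
    rw [e2, e3, hI1, hI2]
    simp
  rw [← e1]
  exact hmono
end
end

section
/- Reverse Hölder potentials are Shen potentials: let n ≥ 3 and let V be a nonnegative function on ℝⁿ with V^{n/2} locally integrable and ∫_{ℝⁿ} V > 0, satisfying the reverse Hölder inequality: there is a constant C_{RH} such that for every ball B ⊂ ℝⁿ, ( ⨍_B V^{n/2} )^{2/n} ≤ C_{RH} ⨍_B V, where ⨍_B denotes the average over B. Then V satisfies the scale-invariant Kato condition (V1) for some constants C₀ > 0 and δ > 0 depending only on n and C_{RH}, and there exists C₁ depending only on n and C_{RH} such that ∫_{B(x,2r)} V ≤ C₁ ∫_{B(x,r)} V for all x ∈ ℝⁿ and r > 0; in particular V satisfies the doubling condition (V2). -/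
open MeasureTheory Metric

noncomputable section

/-- (V1) Scale-invariant Kato condition with constants `C₀, δ`. -/
def KatoV1 (n : ℕ) (C₀ δ : ℝ) (V : EuclideanSpace ℝ (Fin n) → ℝ) : Prop :=
  ∀ x : EuclideanSpace ℝ (Fin n), ∀ r R : ℝ, 0 < r → r < R →
    ∫ y in ball x r, V y ≤ C₀ * (r / R) ^ ((n : ℝ) - 2 + δ) * ∫ y in ball x R, V y

/-- (V2) Doubling on balls with high mass, with constant `C₁`. -/
def DoublingV2 (n : ℕ) (C₁ : ℝ) (V : EuclideanSpace ℝ (Fin n) → ℝ) : Prop :=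
  ∀ x : EuclideanSpace ℝ (Fin n), ∀ r : ℝ, 0 < r →
    ∫ y in ball x (2 * r), V y ≤ C₁ * ((∫ y in ball x r, V y) + r ^ ((n : ℝ) - 2))

section Helpers

variable {n : ℕ}

local notation "EE" n => EuclideanSpace ℝ (Fin n)

lemma rhs_aesm (p : ℝ) (hp : 1 < p) (V : (EE n) → ℝ) (hV : ∀ x, 0 ≤ V x)
    (hLI : LocallyIntegrable (fun x => V x ^ p) volume) (s : Set (EE n)) :
    AEStronglyMeasurable V (volume.restrict s) := by
  have h1 : AEMeasurable (fun x => V x ^ p) volume := hLI.aestronglyMeasurable.aemeasurable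
  have h2 : AEMeasurable (fun x => (V x ^ p) ^ (1 / p)) volume := h1.pow_const _
  have h3 : (fun x => (V x ^ p) ^ (1 / p)) = V := by
    funext x
    rw [← Real.rpow_mul (hV x), mul_one_div_cancel (by linarith), Real.rpow_one]
  rw [h3] at h2
  exact h2.aestronglyMeasurable.restrict

lemma rhs_intp (p : ℝ) (V : (EE n) → ℝ)
    (hLI : LocallyIntegrable (fun x => V x ^ p) volume) (c : EE n) (R : ℝ) :
    IntegrableOn (fun x => V x ^ p) (ball c R) volume :=
  (hLI.integrableOn_isCompact (isCompact_closedBall c R)).mono_set ball_subset_closedBall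

lemma rhs_memLp (p : ℝ) (hp : 1 < p) (V : (EE n) → ℝ) (hV : ∀ x, 0 ≤ V x)
    (hLI : LocallyIntegrable (fun x => V x ^ p) volume) (c : EE n) (R : ℝ) (s : Set (EE n))
    (hs : s ⊆ ball c R) : MemLp V (ENNReal.ofReal p) (volume.restrict s) := by
  have hi := (rhs_intp p V hLI c R).mono_set hs
  have h0 : ENNReal.ofReal p ≠ 0 := by simp; linarith
  rw [← integrable_norm_rpow_iff (rhs_aesm p hp V hV hLI s) h0 ENNReal.ofReal_ne_top,
    ENNReal.toReal_ofReal (by linarith)]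
  refine hi.congr (Filter.Eventually.of_forall fun x => ?_)
  simp [abs_of_nonneg (hV x)]

lemma rhs_fin (c : EE n) (R : ℝ) (s : Set (EE n))
    (hs : s ⊆ ball c R) : volume s < ⊤ :=
  lt_of_le_of_lt (measure_mono hs) measure_ball_lt_top

lemma rhs_int (p : ℝ) (hp : 1 < p) (V : (EE n) → ℝ) (hV : ∀ x, 0 ≤ V x)
    (hLI : LocallyIntegrable (fun x => V x ^ p) volume) (c : EE n) (R : ℝ) :
    IntegrableOn V (ball c R) volume := by
  haveI : IsFiniteMeasure (volume.restrict (ball c R)) := ⟨by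
    rw [Measure.restrict_apply_univ]; exact measure_ball_lt_top⟩
  refine (rhs_memLp p hp V hV hLI c R _ subset_rfl).integrable ?_
  rw [← ENNReal.ofReal_one]
  exact ENNReal.ofReal_le_ofReal hp.le

/-- Hoelder on a set. -/
lemma rhs_holder (p : ℝ) (hp : 1 < p) (V : (EE n) → ℝ) (hV : ∀ x, 0 ≤ V x)
    (hLI : LocallyIntegrable (fun x => V x ^ p) volume) (c : EE n) (R : ℝ) (s : Set (EE n))
    (hs : s ⊆ ball c R) :
    ∫ y in s, V y ≤ (volume.real s) ^ (1 - 1 / p) * (∫ y in s, V y ^ p) ^ (1 / p) := by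
  haveI : IsFiniteMeasure (volume.restrict s) := ⟨by
    rw [Measure.restrict_apply_univ]; exact rhs_fin c R s hs⟩
  have hpq := Real.HolderConjugate.conjExponent hp
  have h := integral_mul_le_Lp_mul_Lq_of_nonneg (μ := volume.restrict s) hpq (f := V)
    (g := fun _ => (1 : ℝ))
    (Filter.Eventually.of_forall hV) (Filter.Eventually.of_forall fun _ => zero_le_one)
    (rhs_memLp p hp V hV hLI c R s hs) (memLp_const 1)
  have hq : 1 / p.conjExponent = 1 - 1 / p := by
    have := hpq.inv_add_inv_eq_one
    simp only [one_div]; linarith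
  rw [hq] at h
  simp only [mul_one, Real.one_rpow, integral_const, smul_eq_mul, measureReal_restrict_apply_univ] at h
  rw [mul_comm]; exact h

lemma rhs_vol (c : EE n) (r : ℝ) (hr : 0 < r) (hn : 0 < n) :
    volume.real (ball c r) = r ^ n * volume.real (ball (0 : EE n) 1) := by
  haveI : Nonempty (Fin n) := ⟨⟨0, hn⟩⟩
  have h := Measure.addHaar_ball_of_pos (volume : Measure (EE n)) c hr
  rw [Measure.real, h, ENNReal.toReal_mul, ENNReal.toReal_ofReal (by positivity)]
  simp [Measure.real]

lemma rhs_vol_pos (c : EE n) (r : ℝ) (hr : 0 < r) : 0 < volume.real (ball c r) :=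
  ENNReal.toReal_pos (measure_ball_pos volume c hr).ne' measure_ball_lt_top.ne

/-- The main estimate for subsets of balls. -/
lemma rhs_sub (p : ℝ) (hp : 1 < p) (C : ℝ) (V : (EE n) → ℝ) (hV : ∀ x, 0 ≤ V x)
    (hLI : LocallyIntegrable (fun x => V x ^ p) volume)
    (hRH : ∀ (c : EE n) (r : ℝ), 0 < r → (∫ y in ball c r, V y ^ p) ^ (1 / p)
      ≤ C * (volume.real (ball c r)) ^ (1 / p - 1) * ∫ y in ball c r, V y)
    (c : EE n) (R : ℝ) (hR : 0 < R) (s : Set (EE n)) (hs : s ⊆ ball c R) :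
    ∫ y in s, V y ≤ C * (volume.real s / volume.real (ball c R)) ^ (1 - 1 / p)
      * ∫ y in ball c R, V y := by
  have hv := rhs_vol_pos c R hR
  calc ∫ y in s, V y ≤ (volume.real s) ^ (1 - 1 / p) * (∫ y in s, V y ^ p) ^ (1 / p) :=
        rhs_holder p hp V hV hLI c R s hs
    _ ≤ (volume.real s) ^ (1 - 1 / p) * (∫ y in ball c R, V y ^ p) ^ (1 / p) := by
        gcongr
        · exact integral_nonneg fun x => Real.rpow_nonneg (hV x) _
        · exact Filter.Eventually.of_forall fun x => Real.rpow_nonneg (hV x) _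
        · exact rhs_intp p V hLI c R
    _ ≤ (volume.real s) ^ (1 - 1 / p) * (C * (volume.real (ball c R)) ^ (1 / p - 1)
          * ∫ y in ball c R, V y) := by
        gcongr
        exact hRH c R hR
    _ = _ := by
        rw [Real.div_rpow measureReal_nonneg hv.le, show 1 / p - 1 = -(1 - 1 / p) by ring,
          Real.rpow_neg hv.le]
        ring

/-- choice of the small annulus -/
lemma rhs_lam (n : ℕ) (a C : ℝ) (ha : 0 < a) :
    ∃ l : ℝ, 0 < l ∧ l < 1 ∧ C * (1 - l ^ n) ^ a ≤ 1 / 2 := by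
  have hc : Filter.Tendsto (fun l : ℝ => C * (1 - l ^ n) ^ a) (nhdsWithin 1 (Set.Iio 1))
      (nhds (C * (1 - 1 ^ n) ^ a)) := by
    have : ContinuousAt (fun l : ℝ => C * (1 - l ^ n) ^ a) 1 := by
      refine continuousAt_const.mul (ContinuousAt.rpow_const (by fun_prop) (Or.inr ha.le))
    exact this.tendsto.mono_left nhdsWithin_le_nhds
  have h0 : C * (1 - 1 ^ n) ^ a < 1 / 2 := by
    simp [Real.zero_rpow ha.ne']
  have h1 := hc.eventually (gt_mem_nhds h0)
  have h2 : ∀ᶠ l : ℝ in nhdsWithin 1 (Set.Iio 1), l ∈ Set.Ioo (0 : ℝ) 1 :=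
    Ioo_mem_nhdsLT zero_lt_one
  obtain ⟨l, h3, h4⟩ := (h1.and h2).exists
  exact ⟨l, h4.1, h4.2, h3.le⟩

lemma rhs_shrink (hn : 0 < n) (p : ℝ) (hp : 1 < p) (C : ℝ) (V : (EE n) → ℝ) (hV : ∀ x, 0 ≤ V x)
    (hLI : LocallyIntegrable (fun x => V x ^ p) volume)
    (hRH : ∀ (c : EE n) (r : ℝ), 0 < r → (∫ y in ball c r, V y ^ p) ^ (1 / p)
      ≤ C * (volume.real (ball c r)) ^ (1 / p - 1) * ∫ y in ball c r, V y)
    (l : ℝ) (hl : 0 < l) (hl1 : l < 1) (hlC : C * (1 - l ^ n) ^ (1 - 1 / p) ≤ 1 / 2)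
    (c : EE n) (R : ℝ) (hR : 0 < R) :
    ∫ y in ball c R, V y ≤ 2 * ∫ y in ball c (l * R), V y := by
  have hsub : ball c (l * R) ⊆ ball c R := ball_subset_ball (by nlinarith)
  have h := rhs_sub p hp C V hV hLI hRH c R hR (ball c R \ ball c (l * R)) Set.diff_subset
  have hd : ∫ y in ball c R \ ball c (l * R), V y
      = (∫ y in ball c R, V y) - ∫ y in ball c (l * R), V y :=
    setIntegral_diff measurableSet_ball (rhs_int p hp V hV hLI c R) hsub
  have hv := rhs_vol_pos c R hR
  have hm : volume.real (ball c R \ ball c (l * R)) / volume.real (ball c R) = 1 - l ^ n := by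
    rw [measureReal_diff hsub measurableSet_ball measure_ball_lt_top.ne,
      rhs_vol c (l * R) (by positivity) hn]
    rw [rhs_vol c R hR hn] at hv ⊢
    have : R ^ n ≠ 0 := by positivity
    have : volume.real (ball (0 : EE n) 1) ≠ 0 := (rhs_vol_pos _ _ one_pos).ne'
    field_simp
    rw [mul_pow]; ring
  rw [hd, hm] at h
  have h0 : 0 ≤ ∫ y in ball c R, V y := integral_nonneg hV
  have := mul_le_mul_of_nonneg_right hlC h0
  linarith

lemma rhs_doubling (hn : 0 < n) (p : ℝ) (hp : 1 < p) (C : ℝ) (V : (EE n) → ℝ) (hV : ∀ x, 0 ≤ V x)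
    (hLI : LocallyIntegrable (fun x => V x ^ p) volume)
    (hRH : ∀ (c : EE n) (r : ℝ), 0 < r → (∫ y in ball c r, V y ^ p) ^ (1 / p)
      ≤ C * (volume.real (ball c r)) ^ (1 / p - 1) * ∫ y in ball c r, V y)
    (l : ℝ) (hl : 0 < l) (hl1 : l < 1) (hlC : C * (1 - l ^ n) ^ (1 - 1 / p) ≤ 1 / 2)
    (k : ℕ) (hk : l ^ k < 1 / 2)
    (c : EE n) (r : ℝ) (hr : 0 < r) :
    ∫ y in ball c (2 * r), V y ≤ 2 ^ k * ∫ y in ball c r, V y := by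
  have key : ∀ j : ℕ, ∫ y in ball c (2 * r), V y ≤ 2 ^ j * ∫ y in ball c (l ^ j * (2 * r)), V y := by
    intro j
    induction j with
    | zero => simp
    | succ j ih =>
      have := rhs_shrink hn p hp C V hV hLI hRH l hl hl1 hlC c (l ^ j * (2 * r)) (by positivity)
      rw [show l * (l ^ j * (2 * r)) = l ^ (j + 1) * (2 * r) by ring] at this
      calc _ ≤ _ := ih
        _ ≤ 2 ^ j * (2 * ∫ y in ball c (l ^ (j + 1) * (2 * r)), V y) := by gcongr
        _ = _ := by ring
  refine (key k).trans ?_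
  gcongr
  · exact Filter.Eventually.of_forall hV
  · exact rhs_int p hp V hV hLI c r
  · nlinarith

/-- doubling of `V ^ p` -/
lemma rhs_doubling_p (hn : 0 < n) (p : ℝ) (hp : 1 < p) (C : ℝ) (hC : 0 < C) (V : (EE n) → ℝ)
    (hV : ∀ x, 0 ≤ V x)
    (hLI : LocallyIntegrable (fun x => V x ^ p) volume)
    (hRH : ∀ (c : EE n) (r : ℝ), 0 < r → (∫ y in ball c r, V y ^ p) ^ (1 / p)
      ≤ C * (volume.real (ball c r)) ^ (1 / p - 1) * ∫ y in ball c r, V y)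
    (D : ℝ) (hD : 0 < D) (hdoub : ∀ (c : EE n) (r : ℝ), 0 < r →
      ∫ y in ball c (2 * r), V y ≤ D * ∫ y in ball c r, V y)
    (c : EE n) (r : ℝ) (hr : 0 < r) :
    ∫ y in ball c (2 * r), V y ^ p ≤ (C * D) ^ p * ∫ y in ball c r, V y ^ p := by
  have hp0 : 0 < p := by linarith
  have hv := rhs_vol_pos c r hr
  have hi : ∀ t, 0 ≤ ∫ y in ball c t, V y ^ p :=
    fun t => integral_nonneg fun x => Real.rpow_nonneg (hV x) _
  have h1 : (∫ y in ball c (2 * r), V y ^ p) ^ (1 / p)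
      ≤ C * D * (∫ y in ball c r, V y ^ p) ^ (1 / p) := by
    have hvol : volume.real (ball c (2 * r)) ^ (1 / p - 1) ≤ volume.real (ball c r) ^ (1 / p - 1) := by
      apply Real.rpow_le_rpow_of_nonpos hv
      · exact measureReal_mono (ball_subset_ball (by linarith)) measure_ball_lt_top.ne
      · have : 1 / p < 1 := by rw [div_lt_one hp0]; exact hp
        linarith
    have hI : 0 ≤ ∫ y in ball c (2 * r), V y := integral_nonneg hV
    calc _ ≤ _ := hRH c (2 * r) (by positivity)
      _ ≤ C * (volume.real (ball c r)) ^ (1 / p - 1) * (D * ∫ y in ball c r, V y) := by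
        gcongr
        exact hdoub c r hr
      _ ≤ C * (volume.real (ball c r)) ^ (1 / p - 1) * (D * ((volume.real (ball c r)) ^ (1 - 1 / p)
            * (∫ y in ball c r, V y ^ p) ^ (1 / p))) := by
        gcongr
        exact rhs_holder p hp V hV hLI c r _ subset_rfl
      _ = C * D * ((volume.real (ball c r)) ^ (1 / p - 1) * (volume.real (ball c r)) ^ (1 - 1 / p))
            * (∫ y in ball c r, V y ^ p) ^ (1 / p) := by ring
      _ = _ := by
        rw [← Real.rpow_add hv]; simp
  have h2 := Real.rpow_le_rpow (Real.rpow_nonneg (hi _) _) h1 hp0.le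
  rw [Real.mul_rpow (by positivity) (Real.rpow_nonneg (hi _) _), ← Real.rpow_mul (hi _),
    ← Real.rpow_mul (hi _), one_div_mul_cancel hp0.ne', Real.rpow_one, Real.rpow_one] at h2
  exact h2

/-- reverse doubling -/
lemma rhs_revdoubling (hn : 0 < n) (W : (EE n) → ℝ) (hW : ∀ x, 0 ≤ W x)
    (hWi : ∀ (c : EE n) (r : ℝ), IntegrableOn W (ball c r) volume)
    (K : ℝ) (hK : 0 < K) (hdoub : ∀ (c : EE n) (r : ℝ), 0 < r →
      ∫ y in ball c (2 * r), W y ≤ K * ∫ y in ball c r, W y)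
    (c : EE n) (r : ℝ) (hr : 0 < r) :
    ∫ y in ball c (r / 2), W y ≤ (K ^ 3 / (1 + K ^ 3)) * ∫ y in ball c r, W y := by
  set e : EE n := EuclideanSpace.single ⟨0, hn⟩ (3 * r / 4) with he
  have hne : ‖e‖ = 3 * r / 4 := by
    rw [he, EuclideanSpace.norm_single, Real.norm_of_nonneg (by positivity)]
  set z := c + e with hz
  have hdz : dist z c = 3 * r / 4 := by rw [hz, dist_eq_norm]; simpa using hne
  have hsub : ball c (r / 2) ⊆ ball c r := ball_subset_ball (by linarith)
  have h1 : ball z (r / 4) ⊆ ball c r \ ball c (r / 2) := by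
    intro y hy
    rw [mem_ball] at hy
    refine ⟨?_, ?_⟩
    · rw [mem_ball]; linarith [dist_triangle y z c]
    · rw [mem_ball, not_lt]; linarith [dist_triangle_left z c y]
  have h2 : ball c (r / 2) ⊆ ball z (2 * (2 * (2 * (r / 4)))) := by
    intro y hy
    rw [mem_ball] at hy ⊢
    linarith [dist_triangle_right y z c]
  have nn : ∀ s : Set (EE n), 0 ≤ᵐ[volume.restrict s] W :=
    fun s => Filter.Eventually.of_forall hW
  have h3 : ∫ y in ball c (r / 2), W y ≤ K ^ 3 * ∫ y in ball z (r / 4), W y := by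
    calc _ ≤ ∫ y in ball z (2 * (2 * (2 * (r / 4)))), W y :=
          setIntegral_mono_set (hWi _ _) (nn _) h2.eventuallyLE
      _ ≤ K * ∫ y in ball z (2 * (2 * (r / 4))), W y := hdoub _ _ (by positivity)
      _ ≤ K * (K * ∫ y in ball z (2 * (r / 4)), W y) := by
          gcongr; exact hdoub _ _ (by positivity)
      _ ≤ K * (K * (K * ∫ y in ball z (r / 4), W y)) := by
          gcongr; exact hdoub _ _ (by positivity)
      _ = _ := by ring
  have h4 : ∫ y in ball z (r / 4), W y ≤ (∫ y in ball c r, W y) - ∫ y in ball c (r / 2), W y := by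
    rw [← setIntegral_diff measurableSet_ball (hWi c r) hsub]
    exact setIntegral_mono_set ((hWi c r).mono_set Set.diff_subset) (nn _) h1.eventuallyLE
  have h5 := mul_le_mul_of_nonneg_left h4 (pow_pos hK 3).le
  rw [div_mul_eq_mul_div, le_div_iff₀ (by positivity)]
  linarith

/-- power decay -/
lemma rhs_decay (W : (EE n) → ℝ) (hW : ∀ x, 0 ≤ W x)
    (hWi : ∀ (c : EE n) (r : ℝ), IntegrableOn W (ball c r) volume)
    (ε : ℝ) (hε : 0 < ε)
    (hrev : ∀ (c : EE n) (r : ℝ), 0 < r →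
      ∫ y in ball c (r / 2), W y ≤ (1 / 2 : ℝ) ^ ε * ∫ y in ball c r, W y)
    (c : EE n) (r R : ℝ) (hr : 0 < r) (hrR : r < R) :
    ∫ y in ball c r, W y ≤ (2 * (r / R)) ^ ε * ∫ y in ball c R, W y := by
  have hR : 0 < R := hr.trans hrR
  have key : ∀ k : ℕ, ∫ y in ball c ((1 / 2) ^ k * R), W y
      ≤ ((1 / 2 : ℝ) ^ k) ^ ε * ∫ y in ball c R, W y := by
    intro k
    induction k with
    | zero => simp
    | succ k ih =>
      have h := hrev c ((1 / 2) ^ k * R) (by positivity)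
      rw [show (1 / 2 : ℝ) ^ k * R / 2 = (1 / 2) ^ (k + 1) * R by ring] at h
      calc _ ≤ _ := h
        _ ≤ (1 / 2 : ℝ) ^ ε * (((1 / 2 : ℝ) ^ k) ^ ε * ∫ y in ball c R, W y) := by gcongr
        _ = _ := by
          rw [pow_succ', Real.mul_rpow (by positivity) (by positivity)]; ring
  obtain ⟨k, hk1, hk2⟩ := exists_nat_pow_near_of_lt_one (x := r / R) (y := 1 / 2)
    (by positivity) (by rw [div_le_one hR]; exact hrR.le) (by norm_num) (by norm_num)
  have hI : 0 ≤ ∫ y in ball c R, W y := integral_nonneg hW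
  calc ∫ y in ball c r, W y ≤ ∫ y in ball c ((1 / 2) ^ k * R), W y := by
        refine setIntegral_mono_set (hWi _ _) (Filter.Eventually.of_forall hW)
          (ball_subset_ball ?_).eventuallyLE
        rwa [div_le_iff₀ hR] at hk2
    _ ≤ ((1 / 2 : ℝ) ^ k) ^ ε * ∫ y in ball c R, W y := key k
    _ ≤ _ := by
        gcongr
        rw [pow_succ] at hk1
        linarith

lemma rhs_kato (hn : 0 < n) (p : ℝ) (hp : 1 < p) (C : ℝ) (hC : 0 < C) (V : (EE n) → ℝ)
    (hV : ∀ x, 0 ≤ V x)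
    (hLI : LocallyIntegrable (fun x => V x ^ p) volume)
    (hRH : ∀ (c : EE n) (r : ℝ), 0 < r → (∫ y in ball c r, V y ^ p) ^ (1 / p)
      ≤ C * (volume.real (ball c r)) ^ (1 / p - 1) * ∫ y in ball c r, V y)
    (ε : ℝ) (hε : 0 < ε)
    (hrev : ∀ (c : EE n) (r : ℝ), 0 < r →
      ∫ y in ball c (r / 2), V y ^ p ≤ (1 / 2 : ℝ) ^ ε * ∫ y in ball c r, V y ^ p)
    (c : EE n) (r R : ℝ) (hr : 0 < r) (hrR : r < R) :
    ∫ y in ball c r, V y ≤ (C * 2 ^ (ε / p)) * (r / R) ^ ((n : ℝ) * (1 - 1 / p) + ε / p)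
      * ∫ y in ball c R, V y := by
  have hR : 0 < R := hr.trans hrR
  have hp0 : 0 < p := by linarith
  have hvR := rhs_vol_pos c R hR
  have hvr := rhs_vol_pos c r hr
  have hW : ∀ x, 0 ≤ V x ^ p := fun x => Real.rpow_nonneg (hV x) _
  have hI : 0 ≤ ∫ y in ball c R, V y ^ p := integral_nonneg hW
  have hx : 0 < r / R := by positivity
  have hratio : volume.real (ball c r) / volume.real (ball c R) = (r / R) ^ (n : ℝ) := by
    rw [rhs_vol c r hr hn, rhs_vol c R hR hn, Real.rpow_natCast, div_pow]
    have : volume.real (ball (0 : EE n) 1) ≠ 0 := (rhs_vol_pos _ _ one_pos).ne'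
    field_simp
  calc ∫ y in ball c r, V y
      ≤ (volume.real (ball c r)) ^ (1 - 1 / p) * (∫ y in ball c r, V y ^ p) ^ (1 / p) :=
        rhs_holder p hp V hV hLI c r _ subset_rfl
    _ ≤ (volume.real (ball c r)) ^ (1 - 1 / p)
        * ((2 * (r / R)) ^ ε * ∫ y in ball c R, V y ^ p) ^ (1 / p) := by
        gcongr
        · exact integral_nonneg hW
        · exact rhs_decay _ hW (rhs_intp p V hLI) ε hε hrev c r R hr hrR
    _ = (volume.real (ball c r)) ^ (1 - 1 / p) * ((2 ^ (ε / p) * (r / R) ^ (ε / p))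
        * (∫ y in ball c R, V y ^ p) ^ (1 / p)) := by
        rw [Real.mul_rpow (by positivity) hI, ← Real.rpow_mul (by positivity), mul_one_div,
          Real.mul_rpow (by norm_num) hx.le]
    _ ≤ (volume.real (ball c r)) ^ (1 - 1 / p) * ((2 ^ (ε / p) * (r / R) ^ (ε / p))
        * (C * (volume.real (ball c R)) ^ (1 / p - 1) * ∫ y in ball c R, V y)) := by
        gcongr
        exact hRH c R hR
    _ = (C * 2 ^ (ε / p)) * ((volume.real (ball c r) / volume.real (ball c R)) ^ (1 - 1 / p)
        * (r / R) ^ (ε / p)) * ∫ y in ball c R, V y := by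
        rw [Real.div_rpow hvr.le hvR.le, show 1 / p - 1 = -(1 - 1 / p) by ring,
          Real.rpow_neg hvR.le]
        ring
    _ = _ := by
        rw [hratio, ← Real.rpow_mul hx.le, ← Real.rpow_add hx]

lemma rhs_RH (p : ℝ) (hp : 1 < p) (C : ℝ) (V : (EE n) → ℝ)
    (hV : ∀ x, 0 ≤ V x) (C' : ℝ) (hCC : C' ≤ C) (c : EE n) (r : ℝ) (hr : 0 < r)
    (h : (⨍ y in ball c r, V y ^ p) ^ (1 / p) ≤ C' * ⨍ y in ball c r, V y) :
    (∫ y in ball c r, V y ^ p) ^ (1 / p)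
      ≤ C * (volume.real (ball c r)) ^ (1 / p - 1) * ∫ y in ball c r, V y := by
  have hv := rhs_vol_pos c r hr
  have hI : 0 ≤ ∫ y in ball c r, V y := integral_nonneg hV
  have hJ : 0 ≤ ∫ y in ball c r, V y ^ p := integral_nonneg fun x => Real.rpow_nonneg (hV x) _
  rw [setAverage_eq, setAverage_eq, smul_eq_mul, smul_eq_mul,
    Real.mul_rpow (by positivity) hJ, Real.inv_rpow hv.le] at h
  have hvp : 0 < volume.real (ball c r) ^ (1 / p) := Real.rpow_pos_of_pos hv _
  rw [inv_mul_le_iff₀ hvp] at h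
  rw [Real.rpow_sub_one hv.ne']
  calc _ ≤ _ := h
    _ ≤ volume.real (ball c r) ^ (1 / p) * (C * ((volume.real (ball c r))⁻¹ * ∫ y in ball c r, V y)) := by
        gcongr
    _ = _ := by ring

end Helpers

/-- Reverse Hölder potentials are Shen potentials: a nonnegative nondegenerate
`V ∈ RH_{n/2}` satisfies the scale-invariant Kato condition (V1) and is doubling
(hence satisfies (V2)), with constants depending only on `n` and the reverse Hölder
constant. -/
theorem reverse_holder_implies_shen
    (n : ℕ) (hn : 3 ≤ n) (C_RH : ℝ) :
    ∃ C₀ δ C₁ : ℝ, 0 < C₀ ∧ 0 < δ ∧ 0 < C₁ ∧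
      ∀ V : EuclideanSpace ℝ (Fin n) → ℝ, (∀ x, 0 ≤ V x) →
        LocallyIntegrable (fun x => V x ^ ((n : ℝ) / 2)) volume →
        (0 < ∫⁻ y, ENNReal.ofReal (V y)) →
        (∀ (c : EuclideanSpace ℝ (Fin n)) (r : ℝ), 0 < r →
          (⨍ y in ball c r, V y ^ ((n : ℝ) / 2)) ^ ((2 : ℝ) / n)
            ≤ C_RH * ⨍ y in ball c r, V y) →
        KatoV1 n C₀ δ V ∧
        (∀ (x : EuclideanSpace ℝ (Fin n)) (r : ℝ), 0 < r →
          ∫ y in ball x (2 * r), V y ≤ C₁ * ∫ y in ball x r, V y) ∧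
        DoublingV2 n C₁ V := by
  have hn0 : 0 < n := by omega
  have hnR : (3 : ℝ) ≤ n := by exact_mod_cast hn
  set p : ℝ := (n : ℝ) / 2 with hpdef
  have hp : 1 < p := by rw [hpdef]; linarith
  have hp0 : 0 < p := by linarith
  have h2n : (2 : ℝ) / n = 1 / p := by rw [hpdef]; field_simp
  have ha : 0 < 1 - 1 / p := by
    have : 1 / p < 1 := by rw [div_lt_one hp0]; exact hp
    linarith
  set C : ℝ := max C_RH 1 with hCdef
  have hC : 0 < C := lt_of_lt_of_le one_pos (le_max_right _ _)
  obtain ⟨l, hl, hl1, hlC⟩ := rhs_lam n (1 - 1 / p) C ha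
  obtain ⟨k, hk⟩ := exists_pow_lt_of_lt_one (show (0 : ℝ) < 1 / 2 by norm_num) hl1
  set K : ℝ := (C * 2 ^ k) ^ p with hK
  have hKpos : 0 < K := by positivity
  set θ : ℝ := K ^ 3 / (1 + K ^ 3) with hθ
  have hθ0 : 0 < θ := by positivity
  have hθ1 : θ < 1 := by rw [hθ, div_lt_one (by positivity)]; linarith
  set ε : ℝ := Real.logb (1 / 2) θ with hεdef
  have hε : 0 < ε := Real.logb_pos_of_base_lt_one (by norm_num) (by norm_num) hθ0 hθ1
  have hεθ : (1 / 2 : ℝ) ^ ε = θ := Real.rpow_logb (by norm_num) (by norm_num) hθ0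
  refine ⟨C * 2 ^ (ε / p), ε / p, 2 ^ k, by positivity, by positivity, by positivity, ?_⟩
  intro V hV hLI _ hRH0
  have hRH : ∀ (c : EuclideanSpace ℝ (Fin n)) (r : ℝ), 0 < r →
      (∫ y in ball c r, V y ^ p) ^ (1 / p)
      ≤ C * (volume.real (ball c r)) ^ (1 / p - 1) * ∫ y in ball c r, V y := by
    intro c r hr
    have h := hRH0 c r hr
    rw [h2n] at h
    exact rhs_RH p hp C V hV C_RH (le_max_left _ _) c r hr h
  have hdoub : ∀ (c : EuclideanSpace ℝ (Fin n)) (r : ℝ), 0 < r →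
      ∫ y in ball c (2 * r), V y ≤ 2 ^ k * ∫ y in ball c r, V y :=
    fun c r hr => rhs_doubling hn0 p hp C V hV hLI hRH l hl hl1 hlC k hk c r hr
  refine ⟨?_, hdoub, ?_⟩
  · intro x r R hr hrR
    have hrev : ∀ (c : EuclideanSpace ℝ (Fin n)) (r : ℝ), 0 < r →
        ∫ y in ball c (r / 2), V y ^ p ≤ (1 / 2 : ℝ) ^ ε * ∫ y in ball c r, V y ^ p := by
      rw [hεθ]
      exact rhs_revdoubling hn0 (fun y => V y ^ p) (fun x => Real.rpow_nonneg (hV x) _)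
        (rhs_intp p V hLI) K hKpos
        (rhs_doubling_p hn0 p hp C hC V hV hLI hRH (2 ^ k) (by positivity) hdoub)
    have h := rhs_kato hn0 p hp C hC V hV hLI hRH ε hε hrev x r R hr hrR
    have he : (n : ℝ) * (1 - 1 / p) = (n : ℝ) - 2 := by
      rw [← h2n]; field_simp
    rwa [he] at h
  · intro x r hr
    refine (hdoub x r hr).trans ?_
    gcongr
    have : 0 ≤ r ^ ((n : ℝ) - 2) := Real.rpow_nonneg hr.le _
    linarith
end
end

section
/- Reverse Hölder property of the magnetic field in the counterexample to Shen's conjecture: let n ≥ 1, let α ∈ (0,1), and define w : ℝⁿ → [0,∞] by w(x) = Σ_{j=1}^n |x_j|^{α−1}. Then w is locally p-integrable for every p ∈ [1, 1/(1−α)), and for each p ∈ (1, 1/(1−α)) there exists a constant C, depending only on n, α and p, such that for every axis-parallel cube Q ⊂ ℝⁿ, ( ⨍_Q w^p )^{1/p} ≤ C ⨍_Q w; that is, w belongs to the reverse Hölder class RH_p. -/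
open MeasureTheory Metric

noncomputable section

/-- The singular weight `w(x) = Σ_j |x_j|^{α−1}` of Example 1. -/
def wEx (n : ℕ) (α : ℝ) (x : EuclideanSpace ℝ (Fin n)) : ℝ :=
  ∑ j, |x j| ^ (α - 1)

/-- The axis-parallel cube with lower corner `c` and sidelength `s`. -/
def cube (n : ℕ) (c : Fin n → ℝ) (s : ℝ) : Set (EuclideanSpace ℝ (Fin n)) :=
  {x | ∀ j, x j ∈ Set.Icc (c j) (c j + s)}

theorem aux_ii (β : ℝ) (h1 : β < 1) (a b : ℝ) :
    IntervalIntegrable (fun t : ℝ => |t| ^ (-β)) volume a b := by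
  apply intervalIntegrable_of_even (fun x => by simp)
  intro x hx
  refine (intervalIntegral.intervalIntegrable_rpow' (r := -β) (by linarith) (a := 0) (b := x)).congr ?_
  intro t ht
  rw [Set.uIoc_of_le hx.le] at ht
  simp only [abs_of_pos ht.1]

theorem aux_on (β : ℝ) (h1 : β < 1) (a b : ℝ) :
    IntegrableOn (fun t : ℝ => |t| ^ (-β)) (Set.Icc a b) volume := by
  rcases le_total a b with h | h
  · rw [integrableOn_Icc_iff_integrableOn_Ioc]
    exact (intervalIntegrable_iff_integrableOn_Ioc_of_le h).1 (aux_ii β h1 a b)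
  · exact (show IntegrableOn (fun t : ℝ => |t| ^ (-β)) {a} volume from
      integrableOn_singleton (by simp) (by simp)).mono_set (by
      intro t ht; simp only [Set.mem_Icc] at ht; simp only [Set.mem_singleton_iff]; linarith)

theorem aux_sym (β : ℝ) (h1 : β < 1) (M : ℝ) (hM : 0 < M) :
    ∫ t in (-M)..M, |t| ^ (-β) = 2 * (M ^ (1 - β) / (1 - β)) := by
  rw [← intervalIntegral.integral_add_adjacent_intervals (b := 0) (aux_ii β h1 _ _) (aux_ii β h1 _ _)]
  have e1 : ∫ t in (0:ℝ)..M, |t| ^ (-β) = M ^ (1 - β) / (1 - β) := by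
    have : ∫ t in (0:ℝ)..M, |t| ^ (-β) = ∫ t in (0:ℝ)..M, t ^ (-β) := by
      apply intervalIntegral.integral_congr
      intro t ht
      rw [Set.uIcc_of_le hM.le] at ht
      simp only [abs_of_nonneg ht.1]
    rw [this, integral_rpow (Or.inl (by linarith)), Real.zero_rpow (by linarith)]
    rw [show -β + 1 = 1 - β by ring, sub_zero]
  have e2 : ∫ t in (-M)..0, |t| ^ (-β) = ∫ t in (0:ℝ)..M, |t| ^ (-β) := by
    have := intervalIntegral.integral_comp_neg (a := 0) (b := M) (fun t : ℝ => |t| ^ (-β))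
    simp only [abs_neg, neg_zero] at this
    exact this.symm
  rw [e2, e1]; ring

theorem aux_up (β : ℝ) (h0 : 0 < β) (h1 : β < 1) (c s : ℝ) (hs : 0 < s) :
    ∫ t in Set.Icc c (c + s), |t| ^ (-β)
      ≤ (2 ^ β + 4 / (1 - β)) * s * (max |c| |c + s|) ^ (-β) := by
  set M := max |c| |c + s| with hMdef
  have hc : |c| ≤ M := le_max_left _ _
  have hcs : |c + s| ≤ M := le_max_right _ _
  have hb : ∀ t ∈ Set.Icc c (c + s), |t| ≤ M := by
    intro t ht
    rw [abs_le] at *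
    exact ⟨by linarith [ht.1], by linarith [ht.2]⟩
  have hM : 0 < M := by
    by_contra h
    have h1 := abs_le.1 hc
    have h2 := abs_le.1 hcs
    linarith [h1.1, h2.2]
  have hpos : 0 < M ^ (-β) := Real.rpow_pos_of_pos hM _
  have hb1 : 0 < 1 - β := by linarith
  rcases le_total (2 * s) M with h | h
  · have hlow : ∀ t ∈ Set.Icc c (c + s), M / 2 ≤ |t| := by
      intro t ht
      rcases le_max_iff.1 (le_refl M) with h' | h'
      · have := abs_sub_abs_le_abs_sub c t
        have h3 : |c - t| ≤ s := by rw [abs_le]; exact ⟨by linarith [ht.2], by linarith [ht.1]⟩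
        linarith
      · have := abs_sub_abs_le_abs_sub (c + s) t
        have h3 : |c + s - t| ≤ s := by rw [abs_le]; exact ⟨by linarith [ht.2], by linarith [ht.1]⟩
        linarith
    calc ∫ t in Set.Icc c (c + s), |t| ^ (-β)
        ≤ ∫ t in Set.Icc c (c + s), (2 ^ β * M ^ (-β)) := by
          apply setIntegral_mono_on (aux_on β h1 _ _)
            (integrableOn_const (by simp)) measurableSet_Icc
          intro t ht
          have := Real.rpow_le_rpow_of_nonpos (by positivity) (hlow t ht) (z := -β) (by linarith)
          refine this.trans (le_of_eq ?_)
          rw [Real.div_rpow hM.le (by norm_num), Real.rpow_neg (by norm_num : (0:ℝ) ≤ 2)]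
          field_simp
      _ = 2 ^ β * s * M ^ (-β) := by
          simp [hs.le]; ring
      _ ≤ _ := by
          gcongr
          have : 0 < 4 / (1 - β) := by positivity
          linarith
  · calc ∫ t in Set.Icc c (c + s), |t| ^ (-β)
        ≤ ∫ t in Set.Icc (-M) M, |t| ^ (-β) := by
          apply setIntegral_mono_set (aux_on β h1 _ _)
          · exact Filter.Eventually.of_forall (fun t => by positivity)
          · exact (show Set.Icc c (c+s) ⊆ Set.Icc (-M) M from
              fun t ht => abs_le.1 (hb t ht)).eventuallyLE
      _ = 2 * (M ^ (1 - β) / (1 - β)) := by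
          rw [integral_Icc_eq_integral_Ioc, ← intervalIntegral.integral_of_le (by linarith),
            aux_sym β h1 M hM]
      _ = (2 / (1 - β)) * M * M ^ (-β) := by
          rw [sub_eq_add_neg 1 β, Real.rpow_add hM, Real.rpow_one]; ring
      _ ≤ (2 / (1 - β)) * (2 * s) * M ^ (-β) := by gcongr
      _ = (4 / (1 - β)) * s * M ^ (-β) := by ring
      _ ≤ _ := by
          gcongr
          have : (0:ℝ) < 2 ^ β := by positivity
          linarith

theorem aux_restrict (n : ℕ) (c : Fin n → ℝ) (s : ℝ) :
    (volume.restrict (cube n c s)).map (WithLp.ofLp) =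
      Measure.pi (fun j => volume.restrict (Set.Icc (c j) (c j + s))) := by
  have h := PiLp.volume_preserving_ofLp (Fin n)
  have hc : cube n c s = (WithLp.ofLp) ⁻¹' (Set.univ.pi fun j => Set.Icc (c j) (c j + s)) := by
    ext x; simp only [cube, Set.mem_preimage, Set.mem_univ_pi, Set.mem_setOf_eq]
  rw [hc, (h.restrict_preimage (MeasurableSet.univ_pi fun j => measurableSet_Icc)).map_eq,
    volume_pi, Measure.restrict_pi_pi]

theorem aux_meas (n : ℕ) (c : Fin n → ℝ) (s : ℝ) : MeasurableSet (cube n c s) := by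
  have hc : cube n c s = (WithLp.ofLp) ⁻¹' (Set.univ.pi fun j => Set.Icc (c j) (c j + s)) := by
    ext x; simp only [cube, Set.mem_preimage, Set.mem_univ_pi, Set.mem_setOf_eq]
  rw [hc]
  exact (PiLp.volume_preserving_ofLp (Fin n)).measurable (MeasurableSet.univ_pi fun j => measurableSet_Icc)

theorem aux_vol (n : ℕ) (c : Fin n → ℝ) (s : ℝ) (hs : 0 < s) :
    volume (cube n c s) = ENNReal.ofReal (s ^ n) := by
  have h := congrArg (fun μ => μ Set.univ) (aux_restrict n c s)
  simp only at h
  rw [Measure.map_apply (PiLp.volume_preserving_ofLp (Fin n)).measurable MeasurableSet.univ] at h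
  simp [Measure.pi_univ] at h
  rw [h, ENNReal.ofReal_pow hs.le]

theorem aux_map (n : ℕ) (c : Fin n → ℝ) (s : ℝ) (j : Fin n) :
    (volume.restrict (cube n c s)).map (fun x => x j) =
      (ENNReal.ofReal s) ^ (n - 1) • volume.restrict (Set.Icc (c j) (c j + s)) := by
  have : (fun x : EuclideanSpace ℝ (Fin n) => x j) = Function.eval j ∘ WithLp.ofLp := rfl
  rw [this, ← Measure.map_map (measurable_pi_apply j)
    (PiLp.volume_preserving_ofLp (Fin n)).measurable, aux_restrict, Measure.pi_map_eval]
  simp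

theorem aux_int (n : ℕ) (c : Fin n → ℝ) (s : ℝ) (j : Fin n) (β : ℝ) (h1 : β < 1) :
    IntegrableOn (fun x : EuclideanSpace ℝ (Fin n) => |x j| ^ (-β)) (cube n c s) volume := by
  have hm : Measurable (fun x : EuclideanSpace ℝ (Fin n) => x j) := by fun_prop
  have h2 : Integrable (fun t : ℝ => |t| ^ (-β))
      ((volume.restrict (cube n c s)).map (fun x => x j)) := by
    rw [aux_map]
    exact (aux_on β h1 _ _).smul_measure (by finiteness)
  exact h2.comp_measurable hm

theorem aux_eval (n : ℕ) (hn : 1 ≤ n) (c : Fin n → ℝ) (s : ℝ) (hs : 0 < s) (j : Fin n) (β : ℝ)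
    (h0 : 0 < β) (h1 : β < 1) :
    ∫ x in cube n c s, |x j| ^ (-β) ≤
      (2 ^ β + 4 / (1 - β)) * s ^ n * (max |c j| |c j + s|) ^ (-β) := by
  have hm : Measurable (fun x : EuclideanSpace ℝ (Fin n) => x j) := by fun_prop
  have h2 := integral_map (μ := volume.restrict (cube n c s)) hm.aemeasurable
    (f := fun t : ℝ => |t| ^ (-β)) (by
      apply Measurable.aestronglyMeasurable; fun_prop)
  rw [← h2, aux_map, integral_smul_measure, ENNReal.toReal_pow, ENNReal.toReal_ofReal hs.le,
    smul_eq_mul]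
  calc _ ≤ s ^ (n - 1) * ((2 ^ β + 4 / (1 - β)) * s * (max |c j| |c j + s|) ^ (-β)) := by
        gcongr; exact aux_up β h0 h1 _ _ hs
    _ = _ := by
        obtain ⟨m, rfl⟩ : ∃ m, n = m + 1 := ⟨n - 1, by omega⟩
        simp only [Nat.add_sub_cancel, pow_succ]; ring

theorem aux_pt (n : ℕ) (α p : ℝ) (hp : 1 ≤ p) (x : EuclideanSpace ℝ (Fin n)) :
    wEx n α x ^ p ≤ (n : ℝ) ^ (p - 1) * ∑ j, |x j| ^ (-((1 - α) * p)) := by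
  have := Real.rpow_sum_le_const_mul_sum_rpow_of_nonneg (Finset.univ)
    (f := fun j => |x j| ^ (α - 1)) hp (fun i _ => by positivity)
  simp only [Finset.card_univ, Fintype.card_fin] at this
  refine this.trans (le_of_eq ?_)
  congr 1
  refine Finset.sum_congr rfl fun j _ => ?_
  rw [← Real.rpow_mul (abs_nonneg _)]
  congr 1; ring

theorem aux_nonneg (n : ℕ) (α : ℝ) (x : EuclideanSpace ℝ (Fin n)) : 0 ≤ wEx n α x :=
  Finset.sum_nonneg fun _ _ => by positivity

theorem aux_wmeas (n : ℕ) (α : ℝ) : Measurable (wEx n α) := by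
  unfold wEx; fun_prop

theorem aux_sumint (n : ℕ) (p β : ℝ) (h1 : β < 1) (c : Fin n → ℝ) (s : ℝ) :
    IntegrableOn (fun x : EuclideanSpace ℝ (Fin n) => (n : ℝ) ^ (p - 1) * ∑ j, |x j| ^ (-β))
      (cube n c s) volume :=
  (integrable_finsetSum _ fun j _ => aux_int n c s j β h1).const_mul _

theorem aux_wint (n : ℕ) (α p : ℝ) (hp : 1 ≤ p) (h1 : (1 - α) * p < 1) (c : Fin n → ℝ) (s : ℝ) :
    IntegrableOn (fun x => wEx n α x ^ p) (cube n c s) volume := by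
  refine (aux_sumint n p _ h1 c s).mono' ?_ ?_
  · exact ((aux_wmeas n α).pow_const p).aestronglyMeasurable
  · refine Filter.Eventually.of_forall fun x => ?_
    rw [Real.norm_of_nonneg (Real.rpow_nonneg (aux_nonneg n α x) _)]
    exact aux_pt n α p hp x

theorem aux_low (n : ℕ) (α : ℝ) (hα : 0 < α ∧ α < 1) (c : Fin n → ℝ) (s : ℝ) (hs : 0 < s) :
    s ^ n * ∑ j, (max |c j| |c j + s|) ^ (α - 1) ≤ ∫ x in cube n c s, wEx n α x := by
  have hi : IntegrableOn (fun x => wEx n α x) (cube n c s) volume := by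
    simpa using aux_wint n α 1 le_rfl (by linarith) c s
  have hv := aux_vol n c s hs
  calc _ = ∫ x in cube n c s, ∑ j, (max |c j| |c j + s|) ^ (α - 1) := by
        rw [setIntegral_const, Measure.real, hv, ENNReal.toReal_ofReal (by positivity), smul_eq_mul]
    _ ≤ _ := by
        apply integral_mono_ae
        · exact integrable_const_iff.2 (Or.inr ⟨by simp [hv]⟩)
        · exact hi
        have hne : ∀ j, ∀ᵐ x ∂(volume.restrict (cube n c s)), x j ≠ 0 := by
          intro j
          have hm : Measurable (fun x : EuclideanSpace ℝ (Fin n) => x j) := by fun_prop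
          have : ∀ᵐ t ∂((volume.restrict (cube n c s)).map (fun x => x j)), t ≠ 0 := by
            rw [aux_map]
            apply Measure.ae_smul_measure
            exact ae_restrict_of_ae (Measure.ae_ne volume 0)
          exact ae_of_ae_map hm.aemeasurable this
        filter_upwards [ae_all_iff.2 hne, ae_restrict_mem (aux_meas n c s)] with x hx hxc
        refine Finset.sum_le_sum fun j _ => ?_
        apply Real.rpow_le_rpow_of_nonpos (abs_pos.2 (hx j)) _ (by linarith)
        exact abs_le_max_abs_abs (hxc j).1 (hxc j).2

/-- The weight `w(x) = Σ_j |x_j|^{α−1}` is locally `p`-integrable for every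
`p ∈ [1, 1/(1−α))`, and belongs to the reverse Hölder class `RH_p` for every
`p ∈ (1, 1/(1−α))`: `(⨍_Q w^p)^{1/p} ≤ C ⨍_Q w` over all axis-parallel cubes `Q`,
with `C = C(n, α, p)`. -/
theorem example_weight_reverse_holder
    (n : ℕ) (hn : 1 ≤ n) (α : ℝ) (hα : 0 < α ∧ α < 1) :
    (∀ p : ℝ, 1 ≤ p → p < (1 - α)⁻¹ →
      LocallyIntegrable (fun x => wEx n α x ^ p) volume) ∧
    (∀ p : ℝ, 1 < p → p < (1 - α)⁻¹ →
      ∃ C : ℝ, 0 < C ∧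
        ∀ (c : Fin n → ℝ) (s : ℝ), 0 < s →
          (⨍ x in cube n c s, wEx n α x ^ p) ^ (1 / p)
            ≤ C * ⨍ x in cube n c s, wEx n α x) := by
  have h1α : 0 < 1 - α := by linarith [hα.2]
  have hβ : ∀ p : ℝ, p < (1 - α)⁻¹ → (1 - α) * p < 1 := by
    intro p hp
    have := mul_lt_mul_of_pos_left hp h1α
    rwa [mul_inv_cancel₀ h1α.ne'] at this
  refine ⟨fun p hp hp' x => ?_, fun p hp hp' => ?_⟩
  · refine ⟨cube n (fun j => x j - 1) 2, ?_, aux_wint n α p hp (hβ p hp') _ _⟩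
    refine Filter.mem_of_superset (Metric.ball_mem_nhds x one_pos) ?_
    intro y hy j
    have h := PiLp.norm_apply_le (y - x) j
    rw [mem_ball, dist_eq_norm] at hy
    have h2 : |y j - x j| ≤ 1 := by
      have h3 : ‖(y - x) j‖ = |y j - x j| := by simp [Real.norm_eq_abs]
      linarith
    rw [abs_le] at h2
    exact ⟨by linarith [h2.1], by linarith [h2.2]⟩
  · have hb := hβ p hp'
    have hp0 : 0 < p := by linarith
    set β := (1 - α) * p with hβd
    have hb0 : 0 < β := by positivity
    have hb1 : 0 < 1 - β := by linarith
    set K : ℝ := (n : ℝ) ^ (p - 1) * (n * (2 ^ β + 4 / (1 - β))) with hK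
    have hn0 : (0 : ℝ) < n := by exact_mod_cast hn
    have hK0 : 0 < K := by positivity
    refine ⟨K ^ (1 / p), by positivity, fun c s hs => ?_⟩
    have hv : volume.real (cube n c s) = s ^ n := by
      rw [Measure.real, aux_vol n c s hs, ENNReal.toReal_ofReal (by positivity)]
    rw [setAverage_eq, setAverage_eq, hv, smul_eq_mul, smul_eq_mul]
    have hsn : 0 < s ^ n := by positivity
    set W := ∑ j, (max |c j| |c j + s|) ^ (α - 1) with hW
    have hW0 : 0 ≤ W := Finset.sum_nonneg fun _ _ => by positivity
    have hlow : W ≤ (s ^ n)⁻¹ * ∫ x in cube n c s, wEx n α x := by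
      rw [le_inv_mul_iff₀ hsn]
      exact aux_low n α hα c s hs
    have hup : (s ^ n)⁻¹ * ∫ x in cube n c s, wEx n α x ^ p ≤ K * W ^ p := by
      rw [inv_mul_le_iff₀ hsn]
      calc ∫ x in cube n c s, wEx n α x ^ p
          ≤ ∫ x in cube n c s, (n : ℝ) ^ (p - 1) * ∑ j, |x j| ^ (-β) :=
            integral_mono (aux_wint n α p hp.le hb c s) (aux_sumint n p β hb c s)
              (fun x => aux_pt n α p hp.le x)
        _ = (n : ℝ) ^ (p - 1) * ∑ j, ∫ x in cube n c s, |x j| ^ (-β) := by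
            rw [integral_const_mul, integral_finsetSum _ fun j _ => aux_int n c s j β hb]
        _ ≤ (n : ℝ) ^ (p - 1) * ∑ j : Fin n, ((2 ^ β + 4 / (1 - β)) * s ^ n * W ^ p) := by
            gcongr with j _
            refine (aux_eval n hn c s hs j β hb0 hb).trans ?_
            gcongr
            rw [show -β = (α - 1) * p by rw [hβd]; ring, Real.rpow_mul (by positivity)]
            gcongr
            exact Finset.single_le_sum (f := fun j => (max |c j| |c j + s|) ^ (α - 1))
              (fun _ _ => by positivity) (Finset.mem_univ j)
        _ = s ^ n * (K * W ^ p) := by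
            simp only [Finset.sum_const, Finset.card_univ, Fintype.card_fin, nsmul_eq_mul, hK]
            ring
    have hnn : 0 ≤ (s ^ n)⁻¹ * ∫ x in cube n c s, wEx n α x ^ p :=
      mul_nonneg (by positivity)
        (integral_nonneg fun x => Real.rpow_nonneg (aux_nonneg n α x) _)
    calc _ ≤ (K * W ^ p) ^ (1 / p) := Real.rpow_le_rpow hnn hup (by positivity)
      _ = K ^ (1 / p) * W := by
          rw [Real.mul_rpow hK0.le (by positivity), ← Real.rpow_mul hW0,
            mul_one_div_cancel hp0.ne', Real.rpow_one]
      _ ≤ _ := by gcongr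
end
end
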